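/- Let ℓ ∈ {1,…,n} and let x ∈ ℝⁿ satisfy x_n < x_{n−1} < ⋯ < x₁, with x_j > 0 for 1 ≤ j ≤ ℓ and x_j < 0 for ℓ < j ≤ n. Then lim_{t→0+} F̃_n(x,t) = exp( −(1−τ) Σ_{j=1}^ℓ τ^{j−1} x_j ). -/

import Mathlib

open MeasureTheory Filter Set

/-- The point on the vertical contour `Γ_a` at height `φ`. -/
noncomputable def lineZ (a φ : ℝ) : ℂ := (a : ℂ) + φ * Complex.I

/-- The contour-integral formula `F̃_n(x,t)` with nested contours `Γ_{a_1}, …, Γ_{a_n}`;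
each contour integral carries the conventional prefactor `1/(2πi)`, i.e. it is
`(1/(2π)) ∫_ℝ dφ` of the integrand evaluated at `a_j + iφ`. -/
noncomputable def Ftilde (n : ℕ) (τ : ℝ) (a : Fin n → ℝ) (x : Fin n → ℝ) (t : ℝ) : ℂ :=
  (τ : ℂ) ^ (n * (n - 1) / 2) * (1 / (2 * Real.pi)) ^ n *
    ∫ φ : Fin n → ℝ,
      (∏ j : Fin n,
        (1 / lineZ (a j) (φ j)) * (((τ : ℂ) - 1) / (lineZ (a j) (φ j) + (1 - (τ : ℂ)))) *
          Complex.exp ((x j : ℂ) * lineZ (a j) (φ j) + (t : ℂ) / 2 * lineZ (a j) (φ j) ^ 2)) *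
      ∏ pr ∈ Finset.univ.filter (fun pr : Fin n × Fin n => pr.1 < pr.2),
        ((lineZ (a pr.2) (φ pr.2) - lineZ (a pr.1) (φ pr.1)) /
          (lineZ (a pr.2) (φ pr.2) - (τ : ℂ) * lineZ (a pr.1) (φ pr.1)))

lemma tendsto_integral_inv_line {d : ℝ} (hd : d ≠ 0) :
    Tendsto (fun R : ℝ => ∫ y in -R..R, ((d : ℂ) + y * Complex.I)⁻¹) atTop
      (nhds ((Real.pi * (|d| / d) : ℝ) : ℂ)) := by
  have hne : ∀ y : ℝ, (d : ℂ) + y * Complex.I ≠ 0 := fun y h => hd (by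
    simpa using congrArg Complex.re h)
  have hcont : Continuous fun y : ℝ => ((d : ℂ) + y * Complex.I)⁻¹ :=
    Continuous.inv₀ (by fun_prop) hne
  have hcont' : Continuous fun y : ℝ => ((d : ℂ) + (-y : ℝ) * Complex.I)⁻¹ :=
    hcont.comp continuous_neg
  have hscale : ∀ y : ℝ, d⁻¹ * (1 + (y / d) ^ 2)⁻¹ = d / (d ^ 2 + y ^ 2) := fun y => by
    have : 0 < d ^ 2 + y ^ 2 := by positivity
    field_simp
  have hint : Integrable fun y : ℝ => d / (d ^ 2 + y ^ 2) := by
    simp_rw [← hscale]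
    exact (integrable_inv_one_add_sq.comp_div hd).const_mul _
  have hval : ∫ y : ℝ, d / (d ^ 2 + y ^ 2) = Real.pi * (|d| / d) := by
    simp_rw [← hscale]
    rw [integral_const_mul, Measure.integral_comp_div (fun y : ℝ => (1 + y ^ 2)⁻¹),
      integral_univ_inv_one_add_sq, smul_eq_mul]
    ring
  have hlim := intervalIntegral_tendsto_integral hint tendsto_neg_atTop_atBot tendsto_id
  rw [hval] at hlim
  refine ((Complex.continuous_ofReal.tendsto _).comp hlim).congr fun R => ?_
  have hsymm : ∫ y in -R..R, ((d : ℂ) + (-y : ℝ) * Complex.I)⁻¹ =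
      ∫ y in -R..R, ((d : ℂ) + y * Complex.I)⁻¹ := by
    simpa using intervalIntegral.integral_comp_neg (a := -R) (b := R)
      (fun y : ℝ => ((d : ℂ) + y * Complex.I)⁻¹)
  have hsum := intervalIntegral.integral_add (hcont.intervalIntegrable (-R) R (μ := volume))
    (hcont'.intervalIntegrable (-R) R)
  rw [hsymm] at hsum
  have heq : ∫ y in -R..R, (((d : ℂ) + y * Complex.I)⁻¹ + ((d : ℂ) + (-y : ℝ) * Complex.I)⁻¹) =
      2 * ∫ y in -R..R, ((d / (d ^ 2 + y ^ 2) : ℝ) : ℂ) := by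
    rw [← intervalIntegral.integral_const_mul]
    congr 1 with y
    have h1 := hne y
    have h2 := hne (-y)
    have h3 : (d : ℂ) ^ 2 + y ^ 2 ≠ 0 := by
      have : 0 < d ^ 2 + y ^ 2 := by positivity
      exact_mod_cast this.ne'
    have h4 : (d : ℂ) ^ 2 + y ^ 2 = (d + y * Complex.I) * (d + (-y : ℝ) * Complex.I) := by
      push_cast; linear_combination ((y : ℂ) ^ 2) * Complex.I_sq
    push_cast at h2 ⊢
    push_cast at h4
    rw [h4]
    rw [neg_mul, ← sub_eq_add_neg] at h2 ⊢
    field_simp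
    ring
  rw [heq, intervalIntegral.integral_ofReal] at hsum
  simp only [Function.comp, id]
  linear_combination hsum / 2

lemma integral_line_sub_integral_line {G : ℂ → ℂ} {α β p K : ℝ} (hα : α < p) (hβ : p < β)
    (hd : ∀ w : ℂ, α ≤ w.re → w.re ≤ β → DifferentiableAt ℂ G w)
    (hK : ∀ w : ℂ, α ≤ w.re → w.re ≤ β → ‖G w‖ ≤ K)
    (hiα : Integrable fun y => G (lineZ α y) / (lineZ α y - p))
    (hiβ : Integrable fun y => G (lineZ β y) / (lineZ β y - p)) :
    ∫ y, G (lineZ α y) / (lineZ α y - p) =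
      (∫ y, G (lineZ β y) / (lineZ β y - p)) - 2 * Real.pi * G p := by
  set S : Set ℂ := {w | α ≤ w.re ∧ w.re ≤ β} with hS
  have hSp : S ∈ nhds (p : ℂ) := by
    have h1 : ∀ᶠ w : ℂ in nhds (p : ℂ), α < w.re :=
      Complex.continuous_re.continuousAt.eventually (lt_mem_nhds (by simpa using hα))
    have h2 : ∀ᶠ w : ℂ in nhds (p : ℂ), w.re < β :=
      Complex.continuous_re.continuousAt.eventually (gt_mem_nhds (by simpa using hβ))
    filter_upwards [h1, h2] with w h1 h2 using ⟨h1.le, h2.le⟩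
  have hH : DifferentiableOn ℂ (dslope G p) S :=
    (Complex.differentiableOn_dslope hSp).2 fun w hw => (hd w hw.1 hw.2).differentiableWithinAt
  have hslope : ∀ w : ℂ, w ≠ p → dslope G p w = G w / (w - p) - G p * (w - p)⁻¹ := by
    intro w hw
    rw [dslope_of_ne _ hw, slope_def_field]
    ring
  have hvert : ∀ γ : ℝ, γ ≠ p → α ≤ γ → γ ≤ β →
      Integrable (fun y => G (lineZ γ y) / (lineZ γ y - p)) →
      Tendsto (fun R : ℝ => ∫ y in -R..R, dslope G p (γ + y * Complex.I)) atTop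
        (nhds ((∫ y, G (lineZ γ y) / (lineZ γ y - p)) -
          G p * ((Real.pi * (|γ - p| / (γ - p)) : ℝ) : ℂ))) := by
    intro γ hγ h1 h2 hi
    have hne : γ - p ≠ 0 := sub_ne_zero.2 hγ
    refine ((intervalIntegral_tendsto_integral hi tendsto_neg_atTop_atBot tendsto_id).sub
      ((tendsto_integral_inv_line hne).const_mul (G p))).congr fun R => ?_
    have hcont : Continuous fun y : ℝ => (((γ - p : ℝ) : ℂ) + y * Complex.I)⁻¹ :=
      Continuous.inv₀ (by fun_prop) fun y h => hne (by simpa using congrArg Complex.re h)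
    rw [← intervalIntegral.integral_const_mul, id, ← intervalIntegral.integral_sub
      hi.intervalIntegrable ((hcont.const_mul _).intervalIntegrable _ _)]
    congr 1 with y
    rw [hslope]
    · simp only [lineZ]
      push_cast
      ring_nf
    · intro h
      exact hγ (by simpa using congrArg Complex.re h)
  have hK0 : 0 ≤ K := (norm_nonneg _).trans (hK p (by simpa using hα.le) (by simpa using hβ.le))
  have hhor : ∀ σ : ℝ, |σ| = 1 → Tendsto (fun R : ℝ =>
      ∫ u in α..β, dslope G p (u + (σ * R : ℝ) * Complex.I)) atTop (nhds 0) := by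
    intro σ hσ
    have hb : ∀ᶠ R : ℝ in atTop, ‖∫ u in α..β, dslope G p (u + (σ * R : ℝ) * Complex.I)‖ ≤
        2 * K / R * |β - α| := by
      filter_upwards [eventually_gt_atTop 0] with R hR
      refine intervalIntegral.norm_integral_le_of_norm_le_const fun u hu => ?_
      rw [uIoc_of_le (hα.trans hβ).le] at hu
      have him : |(((u : ℂ) + (σ * R : ℝ) * Complex.I) - p).im| = R := by
        simp [abs_mul, hσ, abs_of_pos hR]
      have hR' : R ≤ ‖((u : ℂ) + (σ * R : ℝ) * Complex.I) - p‖ := him.symm.le.trans (Complex.abs_im_le_norm _)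
      have hne : (u : ℂ) + (σ * R : ℝ) * Complex.I ≠ p := by
        intro h
        rw [h, sub_self, norm_zero] at hR'
        linarith
      rw [dslope_of_ne _ hne, slope_def_field, norm_div]
      have h1 : ‖G ((u : ℂ) + (σ * R : ℝ) * Complex.I)‖ ≤ K :=
        hK _ (by simpa using hu.1.le) (by simpa using hu.2)
      have h2 : ‖G p‖ ≤ K := hK p (by simpa using hα.le) (by simpa using hβ.le)
      have h3 := norm_sub_le (G ((u : ℂ) + (σ * R : ℝ) * Complex.I)) (G p)
      exact div_le_div₀ (by positivity) (by linarith) hR hR'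
    refine squeeze_zero_norm' hb ?_
    have : Tendsto (fun R : ℝ => 2 * K / R) atTop (nhds 0) :=
      tendsto_const_nhds.div_atTop tendsto_id
    simpa using this.mul_const |β - α|
  have hrect : ∀ R : ℝ, (∫ u in α..β, dslope G p (u + ((-1) * R : ℝ) * Complex.I)) -
      (∫ u in α..β, dslope G p (u + (1 * R : ℝ) * Complex.I)) +
      Complex.I * (∫ y in -R..R, dslope G p (β + y * Complex.I)) -
      Complex.I * (∫ y in -R..R, dslope G p (α + y * Complex.I)) = 0 := by
    intro R
    have := Complex.integral_boundary_rect_eq_zero_of_differentiableOn (dslope G p)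
      ⟨α, -R⟩ ⟨β, R⟩ (hH.mono fun w hw => by
        have := hw.1
        simp only [mem_preimage] at this
        rwa [uIcc_of_le (hα.trans hβ).le] at this)
    simpa using this
  have hlim := (((hhor (-1) (by simp)).sub (hhor 1 (by simp))).add
    ((hvert β hβ.ne' (hα.trans hβ).le le_rfl hiβ).const_mul Complex.I)).sub
    ((hvert α hα.ne le_rfl (hα.trans hβ).le hiα).const_mul Complex.I)
  have h0 := tendsto_nhds_unique (hlim.congr hrect) tendsto_const_nhds
  have e1 : |β - p| / (β - p) = 1 := by
    rw [abs_of_pos (sub_pos.2 hβ), div_self (sub_pos.2 hβ).ne']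
  have e2 : |α - p| / (α - p) = -1 := by
    rw [abs_of_neg (sub_neg.2 hα), neg_div, div_self (sub_neg.2 hα).ne]
  rw [e1, e2] at h0
  push_cast at h0
  have h1 := mul_left_cancel₀ Complex.I_ne_zero (a := Complex.I)
    (b := (∫ y, G (lineZ β y) / (lineZ β y - p)) - G p * (Real.pi * 1) -
      ((∫ y, G (lineZ α y) / (lineZ α y - p)) - G p * (Real.pi * -1))) (c := 0)
    (by linear_combination h0)
  linear_combination -h1

/-- The integrand of the nested contour integral, with simple poles at `0` and `-c` in each
variable and cross factors `(z_j - z_i) / (z_j - τ z_i)` for `i < j`. -/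
noncomputable def nestedIntegrand {n : ℕ} (τ c t : ℝ) (x : Fin n → ℝ) (z : Fin n → ℂ) : ℂ :=
  (∏ j, Complex.exp (x j * z j + (t : ℂ) / 2 * z j ^ 2) / (z j * (z j + c))) *
    ∏ i, ∏ j, if i < j then (z j - z i) / (z j - τ * z i) else 1

/-- The integral of `nestedIntegrand` over the vertical contours with abscissae `a`. -/
noncomputable def nestedIntegral {n : ℕ} (τ c t : ℝ) (x a : Fin n → ℝ) : ℂ :=
  ∫ φ : Fin n → ℝ, nestedIntegrand τ c t x fun j => lineZ (a j) (φ j)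

/-- The contours with abscissae `a` stay at distance `δ` from the poles of `nestedIntegrand` and
within the strip of half-width `s`. -/
structure Admissible {n : ℕ} (τ c δ s : ℝ) (a : Fin n → ℝ) : Prop where
  abs_ge : ∀ j, δ ≤ |a j|
  abs_add_ge : ∀ j, δ ≤ |a j + c|
  gap : ∀ i j, i < j → δ ≤ a j - τ * a i
  abs_le : ∀ j, |a j| ≤ s

@[simp] lemma lineZ_re (a φ : ℝ) : (lineZ a φ).re = a := by simp [lineZ]

@[simp] lemma lineZ_im (a φ : ℝ) : (lineZ a φ).im = φ := by simp [lineZ]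

lemma continuous_lineZ (a : ℝ) : Continuous (lineZ a) := by
  unfold lineZ
  fun_prop

lemma add_abs_pow_mul_exp_le {s : ℝ} (hs : 0 < s) (N : ℕ) (y : ℝ) :
    (s + |y|) ^ N * Real.exp (-(y ^ 2 / (2 * s ^ 2))) ≤
      s ^ N * N.factorial * Real.exp 2 * Real.exp (-(4 * s ^ 2)⁻¹ * y ^ 2) := by
  set v := |y| / s with hv
  have hv0 : 0 ≤ v := by positivity
  have hy : |y| = s * v := by rw [hv]; field_simp
  have hy2 : y ^ 2 = s ^ 2 * v ^ 2 := by rw [← sq_abs, hy]; ring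
  have h1 := Real.pow_div_factorial_le_exp (1 + v) (by positivity) N
  rw [div_le_iff₀ (by positivity)] at h1
  have e1 : y ^ 2 / (2 * s ^ 2) = v ^ 2 / 2 := by rw [hy2]; field_simp
  have e2 : -(4 * s ^ 2)⁻¹ * y ^ 2 = -(v ^ 2 / 4) := by rw [hy2]; field_simp
  rw [e1, e2, hy, show s + s * v = s * (1 + v) by ring, mul_pow]
  calc s ^ N * (1 + v) ^ N * Real.exp (-(v ^ 2 / 2))
      ≤ s ^ N * (Real.exp (1 + v) * N.factorial) * Real.exp (-(v ^ 2 / 2)) := by gcongr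
    _ = s ^ N * N.factorial * Real.exp (1 + v + -(v ^ 2 / 2)) := by
        rw [Real.exp_add (1 + v)]; ring
    _ ≤ s ^ N * N.factorial * Real.exp (2 + -(v ^ 2 / 4)) := by
        gcongr s ^ N * N.factorial * Real.exp ?_
        nlinarith [sq_nonneg (v - 2)]
    _ = _ := by rw [Real.exp_add]; ring

lemma norm_exp_quadratic_le {x s : ℝ} (hs : 0 < s) {w : ℂ} (hw : |w.re| ≤ s) :
    ‖Complex.exp (x * w + (((s ^ 2)⁻¹ : ℝ) : ℂ) / 2 * w ^ 2)‖ ≤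
      Real.exp (x * w.re) * Real.exp 1 * Real.exp (-(w.im ^ 2 / (2 * s ^ 2))) := by
  have hre : ((x : ℂ) * w + (((s ^ 2)⁻¹ : ℝ) : ℂ) / 2 * w ^ 2).re =
      x * w.re + (s ^ 2)⁻¹ / 2 * (w.re ^ 2 - w.im ^ 2) := by
    have : ((((s ^ 2)⁻¹ : ℝ) : ℂ) / 2) = (((s ^ 2)⁻¹ / 2 : ℝ) : ℂ) := by push_cast; rfl
    rw [this, Complex.add_re, Complex.re_ofReal_mul, Complex.re_ofReal_mul, pow_two w,
      Complex.mul_re]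
    ring
  rw [Complex.norm_exp, hre, ← Real.exp_add, ← Real.exp_add, Real.exp_le_exp]
  have h1 : w.re ^ 2 ≤ s ^ 2 := sq_le_sq' (abs_le.1 hw).1 (abs_le.1 hw).2
  have h2 : (s ^ 2)⁻¹ / 2 * w.re ^ 2 ≤ 1 := by
    rw [inv_eq_one_div, div_div, div_mul_eq_mul_div, div_le_one (by positivity)]
    nlinarith
  have h3 : (s ^ 2)⁻¹ / 2 * w.im ^ 2 = w.im ^ 2 / (2 * s ^ 2) := by field_simp
  linarith

lemma norm_le_add_abs_im {s : ℝ} {w : ℂ} (hw : |w.re| ≤ s) : ‖w‖ ≤ s + |w.im| :=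
  (Complex.norm_le_abs_re_add_abs_im w).trans (by linarith)

lemma sub_mul_re_le_norm {τ : ℝ} (w z : ℂ) : w.re - τ * z.re ≤ ‖w - τ * z‖ := by
  simpa using Complex.re_le_norm (w - τ * z)

lemma norm_pair_le {τ δ r : ℝ} (hδ : 0 < δ) {w z : ℂ} (h : δ ≤ w.re - τ * z.re)
    (hw : ‖w‖ ≤ r) (hz : ‖z‖ ≤ r) : ‖(w - z) / (w - τ * z)‖ ≤ 2 / δ * r := by
  have hr : 0 ≤ r := (norm_nonneg _).trans hw
  rw [norm_div, div_mul_eq_mul_div]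
  exact div_le_div₀ (by positivity) ((norm_sub_le _ _).trans (by linarith)) hδ
    (h.trans (sub_mul_re_le_norm w z))

lemma norm_nestedIntegrand_le {n : ℕ} {τ c δ s : ℝ} (hδ : 0 < δ) (hδ1 : δ ≤ 1) (hs : 1 ≤ s)
    {a : Fin n → ℝ} (ha : Admissible τ c δ s a) (x φ : Fin n → ℝ) :
    ‖nestedIntegrand τ c (s ^ 2)⁻¹ x fun j => lineZ (a j) (φ j)‖ ≤
      (2 / δ) ^ (n * n) * ∏ j, (Real.exp (x j * a j) * (Real.exp 1 / δ ^ 2 *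
        (s ^ (n * n) * (n * n).factorial * Real.exp 2)) *
          Real.exp (-(4 * s ^ 2)⁻¹ * φ j ^ 2)) := by
  have hs0 : 0 < s := by linarith
  set P := ∏ j, (s + |φ j|) with hP
  have hfac : ∀ j, 1 ≤ s + |φ j| := fun j => by linarith [abs_nonneg (φ j)]
  have hP1 : 1 ≤ P := Finset.one_le_prod fun j _ => hfac j
  have hle : ∀ j, s + |φ j| ≤ P := fun j => by
    rw [hP, ← Finset.mul_prod_erase _ _ (Finset.mem_univ j)]
    exact le_mul_of_one_le_right (by linarith [hfac j]) (Finset.one_le_prod fun j _ => hfac j)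
  have hz : ∀ j, ‖lineZ (a j) (φ j)‖ ≤ P := fun j =>
    (norm_le_add_abs_im (by simpa using ha.abs_le j)).trans (by simpa using hle j)
  have hpairs : ‖∏ i, ∏ j, if i < j then (lineZ (a j) (φ j) - lineZ (a i) (φ i)) /
      (lineZ (a j) (φ j) - τ * lineZ (a i) (φ i)) else 1‖ ≤ (2 / δ * P) ^ (n * n) := by
    have h1 : ∀ i j, ‖if i < j then (lineZ (a j) (φ j) - lineZ (a i) (φ i)) /
        (lineZ (a j) (φ j) - τ * lineZ (a i) (φ i)) else 1‖ ≤ 2 / δ * P := by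
      intro i j
      split_ifs with h
      · exact norm_pair_le hδ (by simpa using ha.gap i j h) (hz j) (hz i)
      · rw [norm_one, div_mul_eq_mul_div, le_div_iff₀ hδ]
        linarith
    simp_rw [norm_prod]
    calc _ ≤ ∏ i : Fin n, ∏ j : Fin n, (2 / δ * P) :=
          Finset.prod_le_prod (fun i _ => Finset.prod_nonneg fun j _ => norm_nonneg _)
            fun i _ => Finset.prod_le_prod (fun j _ => norm_nonneg _) fun j _ => h1 i j
      _ = _ := by simp [pow_mul]
  have hsingle : ∀ j, ‖Complex.exp (x j * lineZ (a j) (φ j) + (((s ^ 2)⁻¹ : ℝ) : ℂ) / 2 *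
      lineZ (a j) (φ j) ^ 2) / (lineZ (a j) (φ j) * (lineZ (a j) (φ j) + c))‖ ≤
      Real.exp (x j * a j) * Real.exp 1 * Real.exp (-(φ j ^ 2 / (2 * s ^ 2))) / δ ^ 2 := by
    intro j
    have h1 := norm_exp_quadratic_le (x := x j) hs0 (w := lineZ (a j) (φ j))
      (by simpa using ha.abs_le j)
    have h2 : δ ≤ ‖lineZ (a j) (φ j)‖ :=
      (ha.abs_ge j).trans (by simpa using Complex.abs_re_le_norm (lineZ (a j) (φ j)))
    have h3 : δ ≤ ‖lineZ (a j) (φ j) + c‖ :=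
      (ha.abs_add_ge j).trans (by simpa using Complex.abs_re_le_norm (lineZ (a j) (φ j) + c))
    rw [lineZ_re, lineZ_im] at h1
    rw [norm_div, norm_mul, pow_two δ]
    gcongr
  rw [nestedIntegrand, norm_mul]
  calc _ ≤ (∏ j, Real.exp (x j * a j) * Real.exp 1 * Real.exp (-(φ j ^ 2 / (2 * s ^ 2))) /
          δ ^ 2) * (2 / δ * P) ^ (n * n) := by
        gcongr
        rw [norm_prod]
        exact Finset.prod_le_prod (fun j _ => norm_nonneg _) fun j _ => hsingle j
    _ = (2 / δ) ^ (n * n) * ∏ j, (Real.exp (x j * a j) * (Real.exp 1 / δ ^ 2 *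
          ((s + |φ j|) ^ (n * n) * Real.exp (-(φ j ^ 2 / (2 * s ^ 2)))))) := by
        rw [mul_pow, hP, ← Finset.prod_pow, mul_left_comm, ← Finset.prod_mul_distrib]
        congr 1
        refine Finset.prod_congr rfl fun j _ => ?_
        ring
    _ ≤ _ := by
        refine mul_le_mul_of_nonneg_left (Finset.prod_le_prod (fun j _ => by positivity)
          fun j _ => ?_) (by positivity)
        rw [mul_assoc (Real.exp (x j * a j)), mul_assoc (Real.exp 1 / δ ^ 2)]
        exact mul_le_mul_of_nonneg_left (mul_le_mul_of_nonneg_left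
          (add_abs_pow_mul_exp_le hs0 _ _) (by positivity)) (by positivity)

lemma continuous_nestedIntegrand {n : ℕ} {τ c δ s t : ℝ} (hδ : 0 < δ)
    {a : Fin n → ℝ} (ha : Admissible τ c δ s a) (x : Fin n → ℝ) :
    Continuous fun φ : Fin n → ℝ => nestedIntegrand τ c t x fun j => lineZ (a j) (φ j) := by
  have hl : ∀ j, Continuous fun φ : Fin n → ℝ => lineZ (a j) (φ j) := fun j =>
    (continuous_lineZ (a j)).comp (continuous_apply j)
  have hre : ∀ {w : ℂ}, w.re ≠ 0 → w ≠ 0 := fun hw h => hw (by rw [h]; rfl)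
  unfold nestedIntegrand
  refine (continuous_finsetProd _ fun j _ => ?_).mul
    (continuous_finsetProd _ fun i _ => continuous_finsetProd _ fun j _ => ?_)
  · have := hl j
    refine Continuous.div (by fun_prop) (by fun_prop) fun φ => mul_ne_zero (hre ?_) (hre ?_)
    · simpa using abs_pos.1 (hδ.trans_le (ha.abs_ge j))
    · simpa using abs_pos.1 (hδ.trans_le (ha.abs_add_ge j))
  · split_ifs with h
    · have := hl j
      have := hl i
      refine Continuous.div (by fun_prop) (by fun_prop) fun φ => hre ?_
      simpa using (hδ.trans_le (ha.gap i j h)).ne'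
    · fun_prop

lemma integrable_nestedIntegrand {n : ℕ} {τ c δ s : ℝ} (hδ : 0 < δ) (hδ1 : δ ≤ 1) (hs : 1 ≤ s)
    {a : Fin n → ℝ} (ha : Admissible τ c δ s a) (x : Fin n → ℝ) :
    Integrable fun φ : Fin n → ℝ =>
      nestedIntegrand τ c (s ^ 2)⁻¹ x fun j => lineZ (a j) (φ j) := by
  refine Integrable.mono' ?_ (continuous_nestedIntegrand hδ ha x).aestronglyMeasurable
    (ae_of_all _ fun φ => norm_nestedIntegrand_le hδ hδ1 hs ha x φ)
  have hs0 : 0 < s := by linarith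
  exact (Integrable.fintype_prod fun j =>
    (integrable_exp_neg_mul_sq (b := (4 * s ^ 2)⁻¹) (by positivity)).const_mul
      (Real.exp (x j * a j) * (Real.exp 1 / δ ^ 2 *
        (s ^ (n * n) * (n * n).factorial * Real.exp 2)))).const_mul _

lemma exists_norm_nestedIntegral_le (n : ℕ) (τ c : ℝ) {δ : ℝ} (hδ : 0 < δ) (hδ1 : δ ≤ 1)
    (x : Fin n → ℝ) : ∃ (K : ℝ) (M : ℕ), ∀ s : ℝ, 1 ≤ s → ∀ a : Fin n → ℝ,
      Admissible τ c δ s a →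
        ‖nestedIntegral τ c (s ^ 2)⁻¹ x a‖ ≤ K * s ^ M * Real.exp (∑ j, x j * a j) := by
  refine ⟨(2 / δ) ^ (n * n) *
    ((Real.exp 1 / δ ^ 2 * ((n * n).factorial * Real.exp 2)) * √(Real.pi * 4)) ^ n,
    (n * n + 1) * n, fun s hs a ha => ?_⟩
  have hs0 : 0 < s := by linarith
  refine (norm_integral_le_of_norm_le ?_
    (ae_of_all _ fun φ => norm_nestedIntegrand_le hδ hδ1 hs ha x φ)).trans_eq ?_
  · exact (Integrable.fintype_prod fun j =>
      (integrable_exp_neg_mul_sq (b := (4 * s ^ 2)⁻¹) (by positivity)).const_mul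
        (Real.exp (x j * a j) * (Real.exp 1 / δ ^ 2 *
          (s ^ (n * n) * (n * n).factorial * Real.exp 2)))).const_mul _
  · rw [integral_const_mul, integral_fintype_prod_volume_eq_prod (fun j (y : ℝ) =>
      Real.exp (x j * a j) * (Real.exp 1 / δ ^ 2 *
        (s ^ (n * n) * (n * n).factorial * Real.exp 2)) * Real.exp (-(4 * s ^ 2)⁻¹ * y ^ 2))]
    simp_rw [integral_const_mul, integral_gaussian]
    have h : √(Real.pi / (4 * s ^ 2)⁻¹) = √(Real.pi * 4) * s := by
      rw [div_inv_eq_mul, ← mul_assoc, Real.sqrt_mul (by positivity), Real.sqrt_sq hs0.le]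
    rw [h, Real.exp_sum, Finset.prod_mul_distrib, Finset.prod_mul_distrib, Finset.prod_const,
      Finset.prod_const, Finset.card_univ, Fintype.card_fin, pow_mul, pow_succ]
    ring

lemma integral_exp_quadratic_shift {x s α β p K : ℝ} {N : ℕ} (hs : 0 < s) (hα : α < p)
    (hβ : p < β) (hαs : -s ≤ α) (hβs : β ≤ s) {f : ℂ → ℂ}
    (hd : ∀ w : ℂ, α ≤ w.re → w.re ≤ β → DifferentiableAt ℂ f w)
    (hK : ∀ w : ℂ, α ≤ w.re → w.re ≤ β → ‖f w‖ ≤ K * (s + |w.im|) ^ N) :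
    ∫ y, Complex.exp (x * lineZ α y + (((s ^ 2)⁻¹ : ℝ) : ℂ) / 2 * lineZ α y ^ 2) *
        f (lineZ α y) / (lineZ α y - p) =
      (∫ y, Complex.exp (x * lineZ β y + (((s ^ 2)⁻¹ : ℝ) : ℂ) / 2 * lineZ β y ^ 2) *
        f (lineZ β y) / (lineZ β y - p)) -
      2 * Real.pi * (Complex.exp (x * p + (((s ^ 2)⁻¹ : ℝ) : ℂ) / 2 * p ^ 2) * f p) := by
  set G : ℂ → ℂ := fun w =>
    Complex.exp (x * w + (((s ^ 2)⁻¹ : ℝ) : ℂ) / 2 * w ^ 2) * f w with hG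
  set C := Real.exp (|x| * s) * Real.exp 1 * (K * (s ^ N * N.factorial * Real.exp 2)) with hC
  have hK0 : 0 ≤ K := by
    have := (norm_nonneg _).trans (hK p (by simpa using hα.le) (by simpa using hβ.le))
    exact nonneg_of_mul_nonneg_left this (by positivity)
  have hGd : ∀ w : ℂ, α ≤ w.re → w.re ≤ β → DifferentiableAt ℂ G w := fun w h1 h2 => by
    have := hd w h1 h2
    fun_prop
  have hGb : ∀ w : ℂ, α ≤ w.re → w.re ≤ β →
      ‖G w‖ ≤ C * Real.exp (-(4 * s ^ 2)⁻¹ * w.im ^ 2) := by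
    intro w h1 h2
    have hw : |w.re| ≤ s := abs_le.2 ⟨hαs.trans h1, h2.trans hβs⟩
    have hxw : x * w.re ≤ |x| * s := by
      calc x * w.re ≤ |x * w.re| := le_abs_self _
        _ = |x| * |w.re| := abs_mul _ _
        _ ≤ _ := by gcongr
    calc ‖G w‖ ≤ (Real.exp (x * w.re) * Real.exp 1 * Real.exp (-(w.im ^ 2 / (2 * s ^ 2)))) *
          (K * (s + |w.im|) ^ N) := by
          rw [hG, norm_mul]
          exact mul_le_mul (norm_exp_quadratic_le hs hw) (hK w h1 h2) (norm_nonneg _)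
            (by positivity)
      _ = Real.exp (x * w.re) * Real.exp 1 *
          (K * ((s + |w.im|) ^ N * Real.exp (-(w.im ^ 2 / (2 * s ^ 2))))) := by ring
      _ ≤ Real.exp (|x| * s) * Real.exp 1 * (K * (s ^ N * N.factorial * Real.exp 2 *
          Real.exp (-(4 * s ^ 2)⁻¹ * w.im ^ 2))) :=
          mul_le_mul (by gcongr) (mul_le_mul_of_nonneg_left (add_abs_pow_mul_exp_le hs _ _) hK0)
            (by positivity) (by positivity)
      _ = _ := by rw [hC]; ring
  have hGi : ∀ γ, α ≤ γ → γ ≤ β → γ ≠ p →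
      Integrable fun y => G (lineZ γ y) / (lineZ γ y - p) := by
    intro γ h1 h2 hγ
    have hpos : 0 < |γ - p| := abs_pos.2 (sub_ne_zero.2 hγ)
    have hle : ∀ y, |γ - p| ≤ ‖lineZ γ y - p‖ := fun y => by
      simpa using Complex.abs_re_le_norm (lineZ γ y - p)
    have hcont : Continuous fun y => G (lineZ γ y) := continuous_iff_continuousAt.2 fun y =>
      ContinuousAt.comp (f := lineZ γ) (g := G)
        (hGd _ (by simpa using h1) (by simpa using h2)).continuousAt
        (continuous_lineZ γ).continuousAt
    refine Integrable.mono' (((integrable_exp_neg_mul_sq (b := (4 * s ^ 2)⁻¹)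
      (by positivity)).const_mul C).div_const |γ - p|)
      (hcont.div ((continuous_lineZ γ).sub continuous_const) fun y =>
        norm_pos_iff.1 (hpos.trans_le (hle y))).aestronglyMeasurable (ae_of_all _ fun y => ?_)
    rw [norm_div]
    have := hGb (lineZ γ y) (by simpa using h1) (by simpa using h2)
    rw [lineZ_im] at this
    exact div_le_div₀ (by positivity) this hpos (hle y)
  have hlt := hα.trans hβ
  refine integral_line_sub_integral_line (K := C) hα hβ hGd (fun w h1 h2 => ?_)
    (hGi α le_rfl hlt.le hα.ne) (hGi β hlt.le le_rfl hβ.ne')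
  refine (hGb w h1 h2).trans (mul_le_of_le_one_right (by positivity) ?_)
  rw [Real.exp_le_one_iff, neg_mul, neg_nonpos]
  positivity

lemma lineZ_insertNth {n : ℕ} (i : Fin (n + 1)) (a : Fin (n + 1) → ℝ) (y : ℝ) (φ : Fin n → ℝ) :
    (fun j => lineZ (a j) (i.insertNth (α := fun _ => ℝ) y φ j)) =
      i.insertNth (α := fun _ => ℂ) (lineZ (a i) y)
        fun j => lineZ (a (i.succAbove j)) (φ j) := by
  funext j
  revert j
  exact (Fin.forall_iff_succAbove i).2 ⟨by simp, by simp⟩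

lemma integrable_comp_insertNth {n : ℕ} (i : Fin (n + 1)) {g : (Fin (n + 1) → ℝ) → ℂ}
    (hg : Integrable g) :
    Integrable (fun p : ℝ × (Fin n → ℝ) => g (i.insertNth (α := fun _ => ℝ) p.1 p.2))
      (volume.prod volume) :=
  ((volume_preserving_piFinSuccAbove (fun _ => ℝ) i).symm _).integrable_comp_emb
    (MeasurableEquiv.measurableEmbedding _) |>.2 hg

lemma integral_insertNth {n : ℕ} (i : Fin (n + 1)) {g : (Fin (n + 1) → ℝ) → ℂ}
    (hg : Integrable g) :
    ∫ φ, g φ = ∫ φ : Fin n → ℝ, ∫ y : ℝ, g (i.insertNth (α := fun _ => ℝ) y φ) := by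
  rw [← integral_prod_symm _ (integrable_comp_insertNth i hg)]
  exact (((volume_preserving_piFinSuccAbove (fun _ => ℝ) i).symm _).integral_comp' g).symm

lemma nestedIntegral_eq_add {n : ℕ} {τ c c' t : ℝ} (i : Fin (n + 1)) {a : Fin (n + 1) → ℝ}
    {b : ℝ} (x : Fin (n + 1) → ℝ) (κ : ℂ)
    (ha : Integrable fun φ : Fin (n + 1) → ℝ =>
      nestedIntegrand τ c t x fun j => lineZ (a j) (φ j))
    (hb : Integrable fun φ : Fin (n + 1) → ℝ =>
      nestedIntegrand τ c t x fun j => lineZ (Function.update a i b j) (φ j))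
    (hn : Integrable fun φ : Fin n → ℝ =>
      nestedIntegrand τ c' t (x ∘ i.succAbove) fun j => lineZ (a (i.succAbove j)) (φ j))
    (h : ∀ φ : Fin n → ℝ,
      ∫ y, nestedIntegrand τ c t x (i.insertNth (α := fun _ => ℂ) (lineZ (a i) y)
          fun j => lineZ (a (i.succAbove j)) (φ j)) =
        (∫ y, nestedIntegrand τ c t x (i.insertNth (α := fun _ => ℂ) (lineZ b y)
          fun j => lineZ (a (i.succAbove j)) (φ j))) +
        κ * nestedIntegrand τ c' t (x ∘ i.succAbove)
          fun j => lineZ (a (i.succAbove j)) (φ j)) :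
    nestedIntegral τ c t x a = nestedIntegral τ c t x (Function.update a i b) +
      κ * nestedIntegral τ c' t (x ∘ i.succAbove) (a ∘ i.succAbove) := by
  have hb' := (integrable_comp_insertNth i hb).integral_prod_right
  simp only [lineZ_insertNth, Function.update_self,
    Function.update_of_ne (Fin.succAbove_ne i _)] at hb'
  rw [nestedIntegral, nestedIntegral, nestedIntegral, integral_insertNth i ha,
    integral_insertNth i hb]
  simp only [lineZ_insertNth, Function.update_self,
    Function.update_of_ne (Fin.succAbove_ne i _), h]
  rw [integral_add hb' (hn.const_mul κ), integral_const_mul]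
  rfl

lemma nestedIntegrand_insertNth_last {n : ℕ} (τ c t : ℝ) (x : Fin (n + 1) → ℝ) (w : ℂ)
    (z : Fin n → ℂ) :
    nestedIntegrand τ c t x ((Fin.last n).insertNth (α := fun _ => ℂ) w z) =
      Complex.exp (x (Fin.last n) * w + (t : ℂ) / 2 * w ^ 2) / (w * (w + c)) *
        (∏ j, (w - z j) / (w - τ * z j)) *
        nestedIntegrand τ c t (x ∘ (Fin.last n).succAbove) z := by
  have h : ∀ j : Fin n, ¬ Fin.last n < j.castSucc := fun j => (Fin.castSucc_lt_last j).le.not_gt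
  simp only [nestedIntegrand, Fin.insertNth_last', Fin.prod_univ_castSucc, Fin.snoc_castSucc,
    Fin.snoc_last, Fin.castSucc_lt_castSucc_iff, Fin.castSucc_lt_last, if_true, lt_irrefl,
    if_false, h, Finset.prod_const_one, mul_one, Finset.prod_mul_distrib, Function.comp,
    Fin.succAbove_last]
  ring

lemma nestedIntegrand_insertNth_zero {n : ℕ} (τ c t : ℝ) (x : Fin (n + 1) → ℝ) (w : ℂ)
    (z : Fin n → ℂ) :
    nestedIntegrand τ c t x ((0 : Fin (n + 1)).insertNth (α := fun _ => ℂ) w z) =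
      Complex.exp (x 0 * w + (t : ℂ) / 2 * w ^ 2) / (w * (w + c)) *
        (∏ j, (z j - w) / (z j - τ * w)) *
        nestedIntegrand τ c t (x ∘ (0 : Fin (n + 1)).succAbove) z := by
  simp only [nestedIntegrand, Fin.insertNth_zero', Fin.prod_univ_succ, Fin.cons_succ,
    Fin.cons_zero, Fin.succ_lt_succ_iff, Fin.succ_pos, if_true, if_false, Fin.not_lt_zero, one_mul, Function.comp, Fin.succAbove_zero]
  ring

lemma norm_prod_pair_le {n : ℕ} {δ s m r : ℝ} (hδ : 0 < δ) (hs : 1 ≤ s) (hm : 1 ≤ m)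
    {z : Fin n → ℂ} (hz : ∀ j, ‖z j‖ ≤ m) {w : ℂ} (hw : |w.re| ≤ s) {F : ℂ → ℂ → ℂ}
    (hF : ∀ j, ∀ r, ‖w‖ ≤ r → ‖z j‖ ≤ r → ‖F w (z j)‖ ≤ 2 / δ * r) {q : ℂ}
    (hq : r ≤ ‖q‖) (hr : 0 < r) :
    ‖(∏ j, F w (z j)) / q‖ ≤ (2 / δ * m) ^ n / r * (s + |w.im|) ^ n := by
  have h1 : 1 ≤ s + |w.im| := by linarith [abs_nonneg w.im]
  have h2 : ∀ j, ‖F w (z j)‖ ≤ 2 / δ * m * (s + |w.im|) := fun j => by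
    rw [mul_assoc]
    refine hF j _ ((norm_le_add_abs_im hw).trans (le_mul_of_one_le_left (by linarith) hm))
      ((hz j).trans (le_mul_of_one_le_right (by linarith) h1))
  rw [norm_div, div_mul_eq_mul_div, ← mul_pow, norm_prod]
  refine div_le_div₀ (by positivity) ?_ hr hq
  exact (Finset.prod_le_prod (fun j _ => norm_nonneg _) fun j _ => h2 j).trans_eq (by simp)

lemma exists_norm_le {n : ℕ} (z : Fin n → ℂ) : ∃ m : ℝ, 1 ≤ m ∧ ∀ j, ‖z j‖ ≤ m :=
  ⟨1 + ∑ j, ‖z j‖, by simpa using Finset.sum_nonneg fun j _ => norm_nonneg (z j), fun j =>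
    (Finset.single_le_sum (f := fun j => ‖z j‖) (fun j _ => norm_nonneg _)
      (Finset.mem_univ j)).trans (by simp)⟩

lemma nestedIntegral_last {n : ℕ} {τ c δ s : ℝ} (hτ : τ ∈ Ioo (0 : ℝ) 1)
    (hδ : 0 < δ) (hδ1 : δ ≤ 1) (hs : 1 ≤ s) {a : Fin (n + 1) → ℝ} (hlow : ∀ j, -c < a j)
    (hup : ∀ j, a j < 0) (ha : Admissible τ c δ s a)
    (ha' : Admissible τ c δ s (Function.update a (Fin.last n) s))
    (hn : Admissible τ c δ s (a ∘ (Fin.last n).succAbove)) (x : Fin (n + 1) → ℝ) :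
    nestedIntegral τ c (s ^ 2)⁻¹ x a =
      nestedIntegral τ c (s ^ 2)⁻¹ x (Function.update a (Fin.last n) s) +
      (-(2 * Real.pi) / c * ((τ : ℂ) ^ n)⁻¹) *
        nestedIntegral τ c (s ^ 2)⁻¹ (x ∘ (Fin.last n).succAbove)
          (a ∘ (Fin.last n).succAbove) := by
  have hs0 : 0 < s := by linarith
  have hre : ∀ {w : ℂ}, w.re ≠ 0 → w ≠ 0 := fun hw h => hw (by rw [h]; rfl)
  refine nestedIntegral_eq_add _ x _ (integrable_nestedIntegrand hδ hδ1 hs ha x)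
    (integrable_nestedIntegrand hδ hδ1 hs ha' x)
    (integrable_nestedIntegrand hδ hδ1 hs hn _) fun φ => ?_
  set z : Fin n → ℂ := fun j => lineZ (a ((Fin.last n).succAbove j)) (φ j) with hz
  have hgap : ∀ w : ℂ, a (Fin.last n) ≤ w.re → ∀ j, δ ≤ w.re - τ * (z j).re := by
    intro w hw j
    have := ha.gap ((Fin.last n).succAbove j) (Fin.last n)
      (by simp)
    simp only [hz, lineZ_re]
    linarith
  have hpole : ∀ w : ℂ, a (Fin.last n) ≤ w.re → δ ≤ (w + c).re := by
    intro w hw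
    have h1 := ha.abs_add_ge (Fin.last n)
    rw [abs_of_pos (by linarith [hlow (Fin.last n)])] at h1
    simp only [Complex.add_re, Complex.ofReal_re]
    linarith
  obtain ⟨m, hm, hzm⟩ := exists_norm_le z
  have habs := abs_le.1 (ha.abs_le (Fin.last n))
  have key := integral_exp_quadratic_shift (x := x (Fin.last n)) (p := 0) hs0
    (hup (Fin.last n)) hs0 habs.1 le_rfl
    (f := fun w => (∏ j, (w - z j) / (w - τ * z j)) / (w + c))
    (K := (2 / δ * m) ^ n / δ) (N := n)
    (fun w h1 h2 => by
      refine DifferentiableAt.div (DifferentiableAt.fun_finsetProd fun j _ =>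
        DifferentiableAt.div (by fun_prop) (by fun_prop) ?_) (by fun_prop) ?_
      · refine hre ?_
        have := hgap w h1 j
        simp only [Complex.sub_re, Complex.re_ofReal_mul]
        linarith
      · exact hre (by linarith [hpole w h1]))
    (fun w h1 h2 => norm_prod_pair_le hδ hs hm hzm (abs_le.2 ⟨habs.1.trans h1, h2⟩)
      (F := fun w z => (w - z) / (w - τ * z))
      (fun j r hw hz => norm_pair_le hδ (hgap w h1 j) hw hz)
      ((hpole w h1).trans (Complex.re_le_norm _)) hδ)
  have hcongr : ∀ γ y : ℝ, nestedIntegrand τ c (s ^ 2)⁻¹ x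
      ((Fin.last n).insertNth (α := fun _ => ℂ) (lineZ γ y) z) =
      Complex.exp (x (Fin.last n) * lineZ γ y + (((s ^ 2)⁻¹ : ℝ) : ℂ) / 2 * lineZ γ y ^ 2) *
        ((∏ j, (lineZ γ y - z j) / (lineZ γ y - τ * z j)) / (lineZ γ y + c)) /
        (lineZ γ y - (0 : ℝ)) *
        nestedIntegrand τ c (s ^ 2)⁻¹ (x ∘ (Fin.last n).succAbove) z := fun γ y => by
    rw [nestedIntegrand_insertNth_last, Complex.ofReal_zero, sub_zero]
    simp only [div_eq_mul_inv, mul_inv]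
    ring
  simp_rw [hcongr]
  rw [integral_mul_const, integral_mul_const, key]
  have hres : ∏ j, ((0 : ℝ) - z j) / ((0 : ℝ) - τ * z j) = ((τ : ℂ) ^ n)⁻¹ := by
    rw [← inv_pow, ← Fin.prod_const]
    refine Finset.prod_congr rfl fun j _ => ?_
    have h1 : z j ≠ 0 := hre (by simpa [hz] using (hup _).ne)
    have h2 : (τ : ℂ) ≠ 0 := by exact_mod_cast hτ.1.ne'
    rw [Complex.ofReal_zero]
    field_simp
    ring
  rw [hres]
  simp only [Complex.ofReal_zero, mul_zero, zero_add, ne_eq, OfNat.ofNat_ne_zero,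
    not_false_eq_true, zero_pow, Complex.exp_zero]
  ring

lemma nestedIntegral_zero {n : ℕ} {τ c δ s : ℝ} (hτ : τ ∈ Ioo (0 : ℝ) 1)
    (hδ : 0 < δ) (hδ1 : δ ≤ 1) (hs : 1 ≤ s) (hcs : c < s) {a : Fin (n + 1) → ℝ}
    (hlow : ∀ j, -c < a j)
    (hup : ∀ j, a j < 0) (ha : Admissible τ c δ s a)
    (ha' : Admissible τ c δ s (Function.update a 0 (-s)))
    (hn : Admissible τ (τ * c) δ s (a ∘ (0 : Fin (n + 1)).succAbove))
    (x : Fin (n + 1) → ℝ) :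
    nestedIntegral τ c (s ^ 2)⁻¹ x a =
      nestedIntegral τ c (s ^ 2)⁻¹ x (Function.update a 0 (-s)) +
      (-(2 * Real.pi) / c * Complex.exp (-(c * x 0) + (((s ^ 2)⁻¹ : ℝ) : ℂ) / 2 * c ^ 2)) *
        nestedIntegral τ (τ * c) (s ^ 2)⁻¹ (x ∘ (0 : Fin (n + 1)).succAbove)
          (a ∘ (0 : Fin (n + 1)).succAbove) := by
  have hs0 : 0 < s := by linarith
  have hre : ∀ {w : ℂ}, w.re ≠ 0 → w ≠ 0 := fun hw h => hw (by rw [h]; rfl)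
  refine nestedIntegral_eq_add _ x _ (integrable_nestedIntegrand hδ hδ1 hs ha x)
    (integrable_nestedIntegrand hδ hδ1 hs ha' x)
    (integrable_nestedIntegrand hδ hδ1 hs hn _) fun φ => ?_
  set z : Fin n → ℂ := fun j => lineZ (a ((0 : Fin (n + 1)).succAbove j)) (φ j) with hz
  have hgap : ∀ w : ℂ, w.re ≤ a 0 → ∀ j, δ ≤ (z j).re - τ * w.re := by
    intro w hw j
    have := ha.gap 0 ((0 : Fin (n + 1)).succAbove j) (by simp)
    have := mul_le_mul_of_nonneg_left hw hτ.1.le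
    simp only [hz, lineZ_re]
    linarith
  have hpole : ∀ w : ℂ, w.re ≤ a 0 → w.re ≤ -δ := by
    intro w hw
    have h1 := ha.abs_ge 0
    rw [abs_of_neg (hup 0)] at h1
    linarith
  obtain ⟨m, hm, hzm⟩ := exists_norm_le z
  have habs := abs_le.1 (ha.abs_le 0)
  have key := integral_exp_quadratic_shift (x := x 0) (p := -c) hs0
    (neg_lt_neg hcs) (hlow 0) le_rfl habs.2
    (f := fun w => (∏ j, (z j - w) / (z j - τ * w)) / w)
    (K := (2 / δ * m) ^ n / δ) (N := n)
    (fun w h1 h2 => by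
      refine DifferentiableAt.div (DifferentiableAt.fun_finsetProd fun j _ =>
        DifferentiableAt.div (by fun_prop) (by fun_prop) ?_) (by fun_prop) ?_
      · refine hre ?_
        have := hgap w h2 j
        simp only [Complex.sub_re, Complex.re_ofReal_mul]
        linarith
      · exact hre (by linarith [hpole w h2]))
    (fun w h1 h2 => norm_prod_pair_le hδ hs hm hzm (abs_le.2 ⟨h1, h2.trans habs.2⟩)
      (F := fun w z => (z - w) / (z - τ * w))
      (fun j r hw hz => norm_pair_le hδ (hgap w h2 j) hz hw)
      (by
        have h3 := Complex.abs_re_le_norm w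
        have h4 := hpole w h2
        rw [abs_of_nonpos (by linarith)] at h3
        linarith) hδ)
  have hcongr : ∀ γ y : ℝ, nestedIntegrand τ c (s ^ 2)⁻¹ x
      ((0 : Fin (n + 1)).insertNth (α := fun _ => ℂ) (lineZ γ y) z) =
      Complex.exp (x 0 * lineZ γ y + (((s ^ 2)⁻¹ : ℝ) : ℂ) / 2 * lineZ γ y ^ 2) *
        ((∏ j, (z j - lineZ γ y) / (z j - τ * lineZ γ y)) / lineZ γ y) /
        (lineZ γ y - (-c : ℝ)) *
        nestedIntegrand τ c (s ^ 2)⁻¹ (x ∘ (0 : Fin (n + 1)).succAbove) z := fun γ y => by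
    rw [nestedIntegrand_insertNth_zero, Complex.ofReal_neg, sub_neg_eq_add]
    simp only [div_eq_mul_inv, mul_inv]
    ring
  have hcancel : (∏ j, (z j - (-c : ℝ)) / (z j - τ * (-c : ℝ))) *
      nestedIntegrand τ c (s ^ 2)⁻¹ (x ∘ (0 : Fin (n + 1)).succAbove) z =
      nestedIntegrand τ (τ * c) (s ^ 2)⁻¹ (x ∘ (0 : Fin (n + 1)).succAbove) z := by
    rw [nestedIntegrand, nestedIntegrand, ← mul_assoc, ← Finset.prod_mul_distrib]
    congr 1
    refine Finset.prod_congr rfl fun j _ => ?_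
    have h1 : z j + c ≠ 0 := hre (by
      have := hlow ((0 : Fin (n + 1)).succAbove j)
      simp only [hz, Complex.add_re, lineZ_re, Complex.ofReal_re]
      linarith)
    have h2 : z j + τ * c ≠ 0 := hre (by
      have h3 := hgap (-c : ℝ) (by simpa using (hlow 0).le) j
      simp only [Complex.add_re, Complex.re_ofReal_mul, Complex.ofReal_re] at h3 ⊢
      linarith)
    have h3 : z j ≠ 0 := hre (by simpa [hz] using (hup _).ne)
    push_cast
    rw [mul_neg, sub_neg_eq_add, sub_neg_eq_add]
    field_simp
  simp_rw [hcongr]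
  rw [integral_mul_const, integral_mul_const, key, ← hcancel]
  have hexp : (x 0 : ℂ) * (-c : ℝ) + (((s ^ 2)⁻¹ : ℝ) : ℂ) / 2 * (-c : ℝ) ^ 2 =
      -(c * x 0) + (((s ^ 2)⁻¹ : ℝ) : ℂ) / 2 * c ^ 2 := by
    push_cast
    ring
  have halg : ∀ A E P W : ℂ, A * W = (A - 2 * Real.pi * (E * (P / (-c : ℝ)))) * W +
      -(2 * Real.pi) / c * E * (P * W) := fun A E P W => by
    rw [Complex.ofReal_neg, div_neg]
    ring
  rw [hexp]
  exact halg _ _ _ _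

lemma Admissible.update {n : ℕ} {τ c δ s b : ℝ} {a : Fin n → ℝ} (ha : Admissible τ c δ s a)
    (i : Fin n) (h1 : δ ≤ |b|) (h2 : δ ≤ |b + c|) (h3 : |b| ≤ s)
    (h4 : ∀ j, j < i → δ ≤ b - τ * a j) (h5 : ∀ j, i < j → δ ≤ a j - τ * b) :
    Admissible τ c δ s (Function.update a i b) := by
  refine ⟨fun j => ?_, fun j => ?_, fun j k hjk => ?_, fun j => ?_⟩
  · rcases eq_or_ne j i with rfl | h
    · simpa using h1
    · simpa [h] using ha.abs_ge j
  · rcases eq_or_ne j i with rfl | h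
    · simpa using h2
    · simpa [h] using ha.abs_add_ge j
  · rcases eq_or_ne j i with rfl | h
    · simpa [hjk.ne'] using h5 k hjk
    · rcases eq_or_ne k i with rfl | h'
      · simpa [h] using h4 j hjk
      · simpa [h, h'] using ha.gap j k hjk
  · rcases eq_or_ne j i with rfl | h
    · simpa using h3
    · simpa [h] using ha.abs_le j

lemma exists_pos_le_one_forall_le {ι : Type*} [Finite ι] {f : ι → ℝ} (hf : ∀ i, 0 < f i) :
    ∃ δ : ℝ, 0 < δ ∧ δ ≤ 1 ∧ ∀ i, δ ≤ f i := by
  rcases isEmpty_or_nonempty ι with h | h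
  · exact ⟨1, one_pos, le_rfl, fun i => h.elim i⟩
  · obtain ⟨i, hi⟩ := Finite.exists_min f
    exact ⟨min (f i) 1, lt_min (hf i) one_pos, min_le_right _ _, fun j =>
      (min_le_left _ _).trans (hi j)⟩

lemma exists_admissible {n : ℕ} {τ c : ℝ} {a : Fin n → ℝ} (hlow : ∀ j, -c < a j)
    (hup : ∀ j, a j < 0) (hgap : ∀ i j, i < j → τ * a i < a j) :
    ∃ δ : ℝ, 0 < δ ∧ δ ≤ 1 ∧ ∀ s, c ≤ s → Admissible τ c δ s a := by
  obtain ⟨δ₁, h1, h1', h1''⟩ := exists_pos_le_one_forall_le (f := fun j => -a j)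
    fun j => by linarith [hup j]
  obtain ⟨δ₂, h2, h2', h2''⟩ := exists_pos_le_one_forall_le (f := fun j => a j + c)
    fun j => by linarith [hlow j]
  obtain ⟨δ₃, h3, h3', h3''⟩ := exists_pos_le_one_forall_le
    (f := fun p : {p : Fin n × Fin n // p.1 < p.2} => a p.1.2 - τ * a p.1.1)
    fun p => by linarith [hgap _ _ p.2]
  refine ⟨min δ₁ (min δ₂ δ₃), by positivity, (min_le_left _ _).trans h1', fun s hs =>
    ⟨fun j => ?_, fun j => ?_, fun i j hij => ?_, fun j => ?_⟩⟩
  · rw [abs_of_neg (hup j)]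
    exact (min_le_left _ _).trans (h1'' j)
  · rw [abs_of_pos (by linarith [hlow j])]
    exact (min_le_right _ _).trans ((min_le_left _ _).trans (h2'' j))
  · exact (min_le_right _ _).trans ((min_le_right _ _).trans (h3'' ⟨(i, j), hij⟩))
  · rw [abs_of_neg (hup j)]
    linarith [hlow j]

lemma Admissible.mono {n : ℕ} {τ c δ δ' s : ℝ} {a : Fin n → ℝ} (ha : Admissible τ c δ s a)
    (h : δ' ≤ δ) : Admissible τ c δ' s a :=
  ⟨fun j => h.trans (ha.abs_ge j), fun j => h.trans (ha.abs_add_ge j),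
    fun i j hij => h.trans (ha.gap i j hij), ha.abs_le⟩

lemma tendsto_pow_mul_exp_neg_mul {r : ℝ} (hr : 0 < r) (M : ℕ) :
    Tendsto (fun s : ℝ => s ^ M * Real.exp (-(r * s))) atTop (nhds 0) := by
  have h := ((Real.tendsto_pow_mul_exp_neg_atTop_nhds_zero M).comp
    (tendsto_id.const_mul_atTop hr)).const_mul (r ^ M)⁻¹
  rw [mul_zero] at h
  refine h.congr fun s => ?_
  simp only [Function.comp, id, mul_pow]
  field_simp

lemma tendsto_nestedIntegral_update {n : ℕ} {τ c δ σ : ℝ} (hδ : 0 < δ) (hδ1 : δ ≤ 1)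
    (i : Fin n) {x : Fin n → ℝ} (hσ : x i * σ < 0) {a : Fin n → ℝ}
    (ha : ∀ᶠ s in atTop, Admissible τ c δ s (Function.update a i (σ * s))) :
    Tendsto (fun s : ℝ => nestedIntegral τ c (s ^ 2)⁻¹ x (Function.update a i (σ * s)))
      atTop (nhds 0) := by
  obtain ⟨K, M, hK⟩ := exists_norm_nestedIntegral_le n τ c hδ hδ1 x
  have hlim := ((tendsto_pow_mul_exp_neg_mul (r := -(x i * σ)) (by linarith) M).const_mul
    (K * Real.exp (∑ j ∈ Finset.univ.erase i, x j * a j)))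
  rw [mul_zero] at hlim
  refine squeeze_zero_norm' ?_ hlim
  filter_upwards [ha, eventually_ge_atTop 1] with s h1 h2
  refine (hK s h2 _ h1).trans_eq ?_
  have hsum : ∑ j, x j * Function.update a i (σ * s) j =
      x i * σ * s + ∑ j ∈ Finset.univ.erase i, x j * a j := by
    rw [← Finset.add_sum_erase _ _ (Finset.mem_univ i), Function.update_self, mul_assoc]
    congr 1
    refine Finset.sum_congr rfl fun j hj => ?_
    rw [Function.update_of_ne (Finset.ne_of_mem_erase hj)]
  rw [hsum, Real.exp_add, neg_mul, neg_neg]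
  ring

lemma nestedIntegral_fin_zero (τ c t : ℝ) (x a : Fin 0 → ℝ) : nestedIntegral τ c t x a = 1 := by
  have h : (volume : Measure (Fin 0 → ℝ)) = Measure.dirac isEmptyElim := Measure.pi_of_empty _ _
  simp [nestedIntegral, nestedIntegrand, h]

lemma tendsto_nestedIntegral_of_neg {τ c : ℝ} (hτ : τ ∈ Ioo (0 : ℝ) 1) (hc : 0 < c) (n : ℕ)
    (x a : Fin n → ℝ) (hlow : ∀ j, -c < a j) (hup : ∀ j, a j < 0)
    (hgap : ∀ i j, i < j → τ * a i < a j) (hx : ∀ j, x j < 0) :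
    Tendsto (fun s : ℝ => nestedIntegral τ c (s ^ 2)⁻¹ x a) atTop
      (nhds ((-(2 * Real.pi) / c) ^ n * ((τ : ℂ) ^ (n * (n - 1) / 2))⁻¹)) := by
  induction n with
  | zero => simp [nestedIntegral_fin_zero]
  | succ n ih =>
    obtain ⟨δ, hδ, hδ1, hadm⟩ := exists_admissible hlow hup hgap
    have hmonoSucc : ∀ i j : Fin n, i < j →
        (Fin.last n).succAbove i < (Fin.last n).succAbove j := fun i j h => by simpa using h
    have hrest : ∀ s, c ≤ s → Admissible τ c δ s (a ∘ (Fin.last n).succAbove) := fun s hs =>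
      ⟨fun j => (hadm s hs).abs_ge _, fun j => (hadm s hs).abs_add_ge _,
        fun i j hij => (hadm s hs).gap _ _ (hmonoSucc i j hij), fun j => (hadm s hs).abs_le _⟩
    have hupd : ∀ᶠ s in atTop,
        Admissible τ c δ s (Function.update a (Fin.last n) (1 * s)) := by
      filter_upwards [eventually_ge_atTop 1, eventually_ge_atTop c] with s h1 h2
      rw [one_mul]
      have habs : |s| = s := abs_of_pos (by linarith)
      refine (hadm s h2).update _ (by linarith) ?_ habs.le (fun j _ => ?_)
        fun j hj => absurd (Fin.le_last j) hj.not_ge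
      · rw [abs_of_pos (by linarith)]
        linarith
      · nlinarith [mul_pos hτ.1 (neg_pos.2 (hup j))]
    have hrem := tendsto_nestedIntegral_update hδ hδ1 (Fin.last n) (x := x) (σ := 1)
      (by simpa using hx _) hupd
    have hlim := hrem.add ((ih (x ∘ (Fin.last n).succAbove) (a ∘ (Fin.last n).succAbove)
      (fun j => hlow _) (fun j => hup _) (fun i j hij => hgap _ _ (hmonoSucc i j hij))
      fun j => hx _).const_mul (-(2 * Real.pi) / c * ((τ : ℂ) ^ n)⁻¹))
    have hval : 0 + -(2 * Real.pi) / c * ((τ : ℂ) ^ n)⁻¹ *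
        ((-(2 * Real.pi) / c) ^ n * ((τ : ℂ) ^ (n * (n - 1) / 2))⁻¹) =
        (-(2 * Real.pi) / c) ^ (n + 1) * ((τ : ℂ) ^ ((n + 1) * (n + 1 - 1) / 2))⁻¹ := by
      rw [Nat.triangle_succ, pow_add (τ : ℂ), mul_inv, pow_succ]
      ring
    rw [hval] at hlim
    refine hlim.congr' ?_
    filter_upwards [eventually_ge_atTop 1, eventually_ge_atTop c, hupd] with s h1 h2 h3
    rw [one_mul] at h3 ⊢
    exact (nestedIntegral_last hτ hδ hδ1 h1 hlow hup (hadm s h2) h3 (hrest s h2) x).symm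

lemma tendsto_nestedIntegral {τ : ℝ} (hτ : τ ∈ Ioo (0 : ℝ) 1) (n : ℕ) (c : ℝ) (hc : 0 < c)
    (ℓ : ℕ) (x a : Fin n → ℝ) (hlow : ∀ j, -c < a j) (hup : ∀ j, a j < 0)
    (hgap : ∀ i j, i < j → τ * a i < a j) (hpos : ∀ j : Fin n, (j : ℕ) < ℓ → 0 < x j)
    (hneg : ∀ j : Fin n, ℓ ≤ (j : ℕ) → x j < 0) :
    Tendsto (fun s : ℝ => nestedIntegral τ c (s ^ 2)⁻¹ x a) atTop
      (nhds ((-(2 * Real.pi) / c) ^ n * ((τ : ℂ) ^ (n * (n - 1) / 2))⁻¹ *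
        Complex.exp (-(c : ℂ) * ∑ j : Fin n,
          if (j : ℕ) < ℓ then (τ : ℂ) ^ (j : ℕ) * (x j : ℂ) else 0))) := by
  induction n generalizing c ℓ with
  | zero => simp [nestedIntegral_fin_zero]
  | succ n ih =>
    cases ℓ with
    | zero =>
      simpa using tendsto_nestedIntegral_of_neg hτ hc (n + 1) x a hlow hup hgap
        fun j => hneg j (Nat.zero_le _)
    | succ ℓ =>
      have hsucc : ∀ j : Fin n, (0 : Fin (n + 1)).succAbove j = j.succ := fun j => by simp
      have hlow' : ∀ j, -(τ * c) < (a ∘ (0 : Fin (n + 1)).succAbove) j := fun j => by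
        have h1 := hgap 0 ((0 : Fin (n + 1)).succAbove j) (by simp)
        have h2 := mul_lt_mul_of_pos_left (hlow 0) hτ.1
        simp only [Function.comp]
        linarith
      have hgap' : ∀ i j : Fin n, i < j → τ * (a ∘ (0 : Fin (n + 1)).succAbove) i <
          (a ∘ (0 : Fin (n + 1)).succAbove) j := fun i j hij => hgap _ _ (by simpa using hij)
      obtain ⟨δ₁, hδ₁, hδ₁1, hadm₁⟩ := exists_admissible hlow hup hgap
      obtain ⟨δ₂, hδ₂, hδ₂1, hadm₂⟩ := exists_admissible hlow' (fun j => hup _) hgap'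
      have hδ : 0 < min δ₁ δ₂ := lt_min hδ₁ hδ₂
      have hδ1 : min δ₁ δ₂ ≤ 1 := (min_le_left _ _).trans hδ₁1
      have hadm := fun s hs => (hadm₁ s hs).mono (min_le_left δ₁ δ₂)
      have hτc : τ * c < c := by nlinarith [hτ.2]
      have hupd : ∀ᶠ s in atTop,
          Admissible τ c (min δ₁ δ₂) s (Function.update a 0 (-1 * s)) := by
        filter_upwards [eventually_ge_atTop 1, eventually_ge_atTop (c + 1),
          eventually_ge_atTop ((c + 1) / τ)] with s h1 h2 h3
        rw [neg_one_mul]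
        rw [div_le_iff₀ hτ.1] at h3
        have habs : |-s| = s := by rw [abs_neg, abs_of_pos (by linarith)]
        refine (hadm s (by linarith)).update _ (by linarith) ?_ habs.le
          (fun j hj => absurd hj (Fin.not_lt_zero j)) fun j _ => ?_
        · rw [abs_of_nonpos (by linarith)]
          linarith
        · linarith [hlow j]
      have hrem := tendsto_nestedIntegral_update hδ hδ1 0 (x := x) (σ := -1)
        (by simpa using hpos 0 (by simp)) hupd
      have hcoef : Tendsto (fun s : ℝ => -(2 * Real.pi) / c *
          Complex.exp (-(c * x 0) + (((s ^ 2)⁻¹ : ℝ) : ℂ) / 2 * c ^ 2)) atTop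
          (nhds (-(2 * Real.pi) / c * Complex.exp (-(c * x 0)))) := by
        have h1 : Tendsto (fun s : ℝ => (((s ^ 2)⁻¹ : ℝ) : ℂ)) atTop (nhds ((0 : ℝ) : ℂ)) :=
          (Complex.continuous_ofReal.tendsto _).comp
            (tendsto_inv_atTop_zero.comp (tendsto_pow_atTop two_ne_zero))
        have h2 : Continuous fun t : ℂ =>
            -(2 * Real.pi) / c * Complex.exp (-(c * x 0) + t / 2 * c ^ 2) := by fun_prop
        have h3 := (h2.tendsto _).comp h1
        simp only [Complex.ofReal_zero, zero_div, zero_mul, add_zero] at h3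
        exact h3
      have hlim := hrem.add (hcoef.mul (ih (τ * c) (mul_pos hτ.1 hc) ℓ
        (x ∘ (0 : Fin (n + 1)).succAbove) (a ∘ (0 : Fin (n + 1)).succAbove)
        hlow' (fun j => hup _) hgap'
        (fun j hj => hpos _ (by simpa using hj)) fun j hj => hneg _ (by simpa using hj)))
      have hτ0 : (τ : ℂ) ≠ 0 := by exact_mod_cast hτ.1.ne'
      have hc0 : (c : ℂ) ≠ 0 := by exact_mod_cast hc.ne'
      have hexp : -(c : ℂ) * ∑ j : Fin (n + 1),
          (if (j : ℕ) < ℓ + 1 then (τ : ℂ) ^ (j : ℕ) * (x j : ℂ) else 0) =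
          -(c * x 0) + -((τ * c : ℝ) : ℂ) * ∑ j : Fin n,
          if (j : ℕ) < ℓ then (τ : ℂ) ^ (j : ℕ) *
            ((x ∘ (0 : Fin (n + 1)).succAbove) j : ℂ) else 0 := by
        rw [Fin.sum_univ_succ, mul_add, Finset.mul_sum, Finset.mul_sum]
        congr 1
        · simp
        · refine Finset.sum_congr rfl fun j _ => ?_
          simp only [Fin.val_succ, add_lt_add_iff_right, Function.comp, hsucc]
          split_ifs
          · push_cast
            ring
          · simp
      have hval : (-(2 * Real.pi) / c) ^ (n + 1) *
          ((τ : ℂ) ^ ((n + 1) * (n + 1 - 1) / 2))⁻¹ =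
          -(2 * Real.pi) / c * ((-(2 * Real.pi) / ((τ * c : ℝ) : ℂ)) ^ n *
            ((τ : ℂ) ^ (n * (n - 1) / 2))⁻¹) := by
        rw [Nat.triangle_succ, pow_add (τ : ℂ), mul_inv, pow_succ, Complex.ofReal_mul,
          mul_comm (τ : ℂ), ← div_div, div_pow _ (τ : ℂ)]
        ring
      rw [hexp, hval, Complex.exp_add]
      rw [zero_add] at hlim
      refine Tendsto.congr' ?_ (hlim.trans_eq ?_)
      · filter_upwards [eventually_ge_atTop 1, eventually_gt_atTop c, hupd] with s h1 h2 h3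
        rw [neg_one_mul] at h3 ⊢
        exact (nestedIntegral_zero hτ hδ hδ1 h1 h2 hlow hup (hadm s h2.le) h3
          ((hadm₂ s (hτc.trans h2).le).mono (min_le_right _ _)) x).symm
      · congr 1
        ring

lemma Ftilde_eq_nestedIntegral (n : ℕ) (τ : ℝ) (a x : Fin n → ℝ) (t : ℝ) :
    Ftilde n τ a x t = (τ : ℂ) ^ (n * (n - 1) / 2) * (1 / (2 * Real.pi)) ^ n *
      (((τ : ℂ) - 1) ^ n * nestedIntegral τ (1 - τ) t x a) := by
  rw [Ftilde, nestedIntegral, ← integral_const_mul (((τ : ℂ) - 1) ^ n)]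
  congr 1
  refine integral_congr_ae (Eventually.of_forall fun φ => ?_)
  beta_reduce
  rw [nestedIntegrand, ← mul_assoc, Finset.prod_filter, ← Finset.univ_product_univ,
    Finset.prod_product, ← Fin.prod_const]
  congr 1
  rw [← Finset.prod_mul_distrib]
  refine Finset.prod_congr rfl fun j _ => ?_
  push_cast
  simp only [div_eq_mul_inv, mul_inv]
  ring

/-- Initial condition on the sector `S_ℓ`: with `x_n < ⋯ < x_1`, `x_j > 0` for the first `ℓ`
indices and `x_j < 0` for the remaining ones,
`lim_{t→0+} F̃_n(x,t) = exp(−(1−τ) Σ_{j=1}^ℓ τ^{j−1} x_j)`. -/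
theorem Ftilde_initial (n : ℕ) (hn : 1 ≤ n) (τ : ℝ) (hτ : τ ∈ Set.Ioo (0 : ℝ) 1)
    (a : Fin n → ℝ) (hlow : ∀ j, -(1 - τ) < a j) (hup : ∀ j, a j < 0)
    (hmono : StrictMono a)
    (hgap : ∀ i j : Fin n, (i : ℕ) + 1 = (j : ℕ) → τ * a i < a j)
    (ℓ : ℕ) (hℓ1 : 1 ≤ ℓ) (hℓn : ℓ ≤ n)
    (x : Fin n → ℝ) (hord : StrictAnti x)
    (hpos : ∀ j : Fin n, (j : ℕ) < ℓ → 0 < x j)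
    (hneg : ∀ j : Fin n, ℓ ≤ (j : ℕ) → x j < 0) :
    Filter.Tendsto (fun t : ℝ => Ftilde n τ a x t) (nhdsWithin 0 (Set.Ioi 0))
      (nhds (Complex.exp (-(1 - (τ : ℂ)) *
        ∑ j ∈ Finset.univ.filter (fun j : Fin n => (j : ℕ) < ℓ),
          (τ : ℂ) ^ (j : ℕ) * (x j : ℂ)))) := by
  have hgap' : ∀ i j : Fin n, i < j → τ * a i < a j := fun i j hij => by
    have h1 : (i : ℕ) + 1 < n := lt_of_le_of_lt hij j.2
    exact (hgap i ⟨i + 1, h1⟩ rfl).trans_le (hmono.monotone (Fin.mk_le_of_le_val hij))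
  have hmain := tendsto_nestedIntegral hτ n (1 - τ) (by linarith [hτ.2]) ℓ x a hlow hup hgap'
    hpos hneg
  have hs : Tendsto (fun t : ℝ => (√t)⁻¹) (nhdsWithin 0 (Ioi 0)) atTop := by
    refine tendsto_inv_nhdsGT_zero.comp (tendsto_nhdsWithin_iff.2 ⟨?_, ?_⟩)
    · simpa using (Real.continuous_sqrt.tendsto 0).mono_left nhdsWithin_le_nhds
    · filter_upwards [self_mem_nhdsWithin] with t ht using Real.sqrt_pos.2 ht
  have hlim := ((hmain.comp hs).const_mul (((τ : ℂ) - 1) ^ n)).const_mul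
    ((τ : ℂ) ^ (n * (n - 1) / 2) * (1 / (2 * Real.pi)) ^ n)
  have hτ0 : (τ : ℂ) ≠ 0 := by exact_mod_cast hτ.1.ne'
  have hτ1 : (1 - τ : ℂ) ≠ 0 := by exact_mod_cast (sub_pos.2 hτ.2).ne'
  have hpi : (Real.pi : ℂ) ≠ 0 := by exact_mod_cast Real.pi_ne_zero
  have hcoef : (1 / (2 * Real.pi) : ℂ) * (((τ : ℂ) - 1) * (-(2 * Real.pi) / (1 - τ))) = 1 := by
    field_simp
    ring
  have hval : ∀ E : ℂ, (τ : ℂ) ^ (n * (n - 1) / 2) * (1 / (2 * Real.pi)) ^ n *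
      (((τ : ℂ) - 1) ^ n * ((-(2 * Real.pi) / (1 - τ)) ^ n *
        ((τ : ℂ) ^ (n * (n - 1) / 2))⁻¹ * E)) = E := fun E => by
    have h1 : (τ : ℂ) ^ (n * (n - 1) / 2) * ((τ : ℂ) ^ (n * (n - 1) / 2))⁻¹ = 1 :=
      mul_inv_cancel₀ (pow_ne_zero _ hτ0)
    have h2 : (1 / (2 * Real.pi) : ℂ) ^ n *
        (((τ : ℂ) - 1) ^ n * (-(2 * Real.pi) / (1 - τ)) ^ n) = 1 := by
      rw [← mul_pow, ← mul_pow, hcoef, one_pow]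
    linear_combination E * h1 + E * ((τ : ℂ) ^ (n * (n - 1) / 2) *
      ((τ : ℂ) ^ (n * (n - 1) / 2))⁻¹) * h2
  push_cast at hlim
  rw [hval] at hlim
  rw [Finset.sum_filter]
  refine hlim.congr' ?_
  filter_upwards [self_mem_nhdsWithin] with t ht
  rw [Ftilde_eq_nestedIntegral, Function.comp, inv_pow, inv_inv, Real.sq_sqrt (le_of_lt ht)]
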